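/- arXiv:1810.05889 — 2 statements merged into one kernel-verified Lean document; each statement's English description precedes it below -/
import Mathlib

section
/- For every integer n ≥ 3 and every integer d ≥ 1, the d-matching polynomial of the n-cycle satisfies 𝒞_{n,d}(x) · 𝒫_{n−1}(x) = 𝒫_{nd+n−1}(x); that is, ((1/(d!)^n) · Σ_{λ : ℤ/nℤ → S_d} M_{C_{n,λ}}(x)) · 𝒫_{n−1}(x) = 𝒫_{nd+n−1}(x) as polynomials in x over ℚ (Hall's conjecture). -/
open Polynomial


noncomputable section

/-- Number of matchings with exactly `m` edges in a simple graph `G`. -/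
def matchingCount {V : Type*} (G : SimpleGraph V) (m : ℕ) : ℕ :=
  Nat.card {M : Finset (Sym2 V) //
    M.card = m ∧ (∀ e ∈ M, e ∈ G.edgeSet) ∧
    ∀ e ∈ M, ∀ f ∈ M, e ≠ f → ∀ v : V, v ∈ e → v ∉ f}

/-- The matching polynomial of a finite simple graph. -/
def matchingPoly {V : Type*} [Fintype V] (G : SimpleGraph V) : ℚ[X] :=
  ∑ i ∈ Finset.range (Fintype.card V + 1),
    Polynomial.C ((-1 : ℚ) ^ i * (matchingCount G i : ℚ)) * X ^ (Fintype.card V - 2 * i)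

/-- Matching polynomial of the path graph on `n` vertices (via the recurrence). -/
def pathPoly : ℕ → ℚ[X]
  | 0 => 1
  | 1 => X
  | n + 2 => X * pathPoly (n + 1) - pathPoly n

/-- Matching polynomial of the cycle graph on `n` vertices (via the recurrence). -/
def cyclePoly : ℕ → ℚ[X]
  | 0 => 2
  | 1 => X
  | n + 2 => X * cyclePoly (n + 1) - cyclePoly n

/-- The degree-`d` cover of the `n`-cycle determined by the labeling `lam`. -/
def coverGraph (n d : ℕ) (lam : ZMod n → Equiv.Perm (Fin d)) :
    SimpleGraph (ZMod n × Fin d) :=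
  SimpleGraph.fromRel fun p q => q.1 = p.1 + 1 ∧ q.2 = lam p.1 p.2

/-- Number of cycles of length `i` (fixed points counted as 1-cycles) of `σ`. -/
def cycleCount {d : ℕ} (σ : Equiv.Perm (Fin d)) (i : ℕ) : ℕ :=
  (Finset.univ.filter fun x : Fin d => Function.minimalPeriod σ x = i).card / i

/-- The product `λ(n-1) ∘ ⋯ ∘ λ(0)` (applying `λ(0)` first). -/
def cycleProd (n d : ℕ) (lam : ZMod n → Equiv.Perm (Fin d)) : Equiv.Perm (Fin d) :=
  (((List.range n).map fun i => lam (i : ZMod n)).reverse).prod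

/-- Sums of `∏ W (f i) (f (i + 1))` over all sequences along a path are entries of powers. -/
theorem sum_prod_matrix_path {ι R : Type*} [Fintype ι] [DecidableEq ι] [CommRing R]
    (W : Matrix ι ι R) (m : ℕ) (h : ι → ι → R) :
    ∑ f : Fin (m + 1) → ι, h (f 0) (f (Fin.last m)) * ∏ i : Fin m, W (f i.castSucc) (f i.succ) =
      ∑ a, ∑ b, h a b * (W ^ m) a b := by
  induction m generalizing h with
  | zero =>
    rw [← (Equiv.funUnique (Fin 1) ι).symm.sum_comp]
    simp [Matrix.one_apply]
  | succ m ih =>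
    rw [← (Fin.consEquiv fun _ : Fin (m + 2) => ι).sum_comp, Fintype.sum_prod_type]
    refine Finset.sum_congr rfl fun a _ => ?_
    have := ih fun c b => h a b * W a c
    simp only [Fin.consEquiv, Equiv.coe_fn_mk, Fin.cons_zero, Fin.prod_univ_succ,
      Fin.castSucc_zero, Fin.cons_succ, ← Fin.succ_last, ← Fin.succ_castSucc]
    simp only [← mul_assoc]
    rw [this, Finset.sum_comm]
    refine Finset.sum_congr rfl fun b _ => ?_
    rw [pow_succ', Matrix.mul_apply, Finset.mul_sum]
    simp only [mul_assoc]

/-- The trace of a matrix power as a sum over closed sequences. -/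
theorem sum_prod_matrix_cycle {ι R : Type*} [Fintype ι] [DecidableEq ι] [CommRing R]
    (W : Matrix ι ι R) (n : ℕ) [NeZero n] :
    ∑ f : ZMod n → ι, ∏ i, W (f i) (f (i + 1)) = (W ^ n).trace := by
  obtain ⟨m, rfl⟩ := Nat.exists_eq_succ_of_ne_zero (NeZero.ne n)
  change ∑ f : Fin (m + 1) → ι, ∏ i : Fin (m + 1), W (f i) (f (i + 1)) = _
  have := sum_prod_matrix_path W m fun a b => W b a
  simp only [Fin.prod_univ_castSucc, Fin.coeSucc_eq_succ, Fin.last_add_one]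
  simp only [mul_comm (W _ _)] at this
  rw [this]
  simp only [Nat.succ_eq_add_one, pow_succ, Matrix.trace, Matrix.diag, Matrix.mul_apply, mul_comm]

/-- Double counting of the permutations that map `S` into the complement of `T`. -/
theorem choose_mul_card_perm_disjoint {α : Type*} [Fintype α] [DecidableEq α] (S T : Finset α) :
    (Fintype.card α).choose T.card *
        (Finset.univ.filter fun σ : Equiv.Perm α => ∀ j ∈ S, σ j ∉ T).card =
      (Fintype.card α).factorial * (Fintype.card α - S.card).choose T.card := by
  have symm : ∀ T' ∈ Finset.powersetCard T.card (Finset.univ : Finset α),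
      (Finset.univ.filter fun σ : Equiv.Perm α => ∀ j ∈ S, σ j ∉ T').card =
        (Finset.univ.filter fun σ : Equiv.Perm α => ∀ j ∈ S, σ j ∉ T).card := by
    intro T' hT'
    obtain ⟨τ, rfl⟩ := Equiv.Perm.exists_map_finset_eq (s := T) (t := T')
      (Finset.mem_powersetCard.1 hT').2.symm
    refine (Finset.card_equiv (Equiv.mulLeft τ) fun σ => ?_).symm
    simp
  have count : ∀ σ : Equiv.Perm α,
      ((Finset.powersetCard T.card Finset.univ).filter fun T' => ∀ j ∈ S, σ j ∉ T').card =
        (Fintype.card α - S.card).choose T.card := by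
    intro σ
    rw [← Finset.card_map σ.toEmbedding (s := S), ← Finset.card_compl, ← Finset.card_powersetCard]
    congr 1
    ext T'
    simp only [Finset.mem_filter, Finset.mem_powersetCard, Finset.subset_univ, true_and,
      Finset.subset_compl_iff_disjoint_left, Finset.disjoint_left,
      Finset.mem_map, Equiv.coe_toEmbedding]
    aesop
  calc _ = ∑ T' ∈ Finset.powersetCard T.card (Finset.univ : Finset α),
        (Finset.univ.filter fun σ : Equiv.Perm α => ∀ j ∈ S, σ j ∉ T').card := by
        rw [Finset.sum_congr rfl symm]; simp
    _ = ∑ σ : Equiv.Perm α,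
        ((Finset.powersetCard T.card Finset.univ).filter fun T' => ∀ j ∈ S, σ j ∉ T').card :=
        Finset.sum_card_bipartiteAbove_eq_sum_card_bipartiteBelow
          fun (T' : Finset α) (σ : Equiv.Perm α) => ∀ j ∈ S, σ j ∉ T'
    _ = _ := by simp [count, Fintype.card_perm]

/-- In a graph whose edges join every `v` to `u v`, matchings correspond to vertex sets `S`
such that `S` is disjoint from `u S`. -/
theorem matchingCount_eq_card_filter {V : Type*} [Fintype V] [DecidableEq V] (G : SimpleGraph V)
    (u : Equiv.Perm V) (hu : ∀ v, u v ≠ v) (huu : ∀ v, u (u v) ≠ v)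
    (hG : ∀ v w, G.Adj v w ↔ w = u v ∨ v = u w) (m : ℕ) :
    matchingCount G m =
      (Finset.univ.filter fun S : Finset V => S.card = m ∧ ∀ v ∈ S, u v ∉ S).card := by
  have inj : Function.Injective fun v => s(v, u v) := by
    intro v w h
    rcases Sym2.eq_iff.1 h with h | h
    · exact h.1
    · exact absurd (by rw [← h.1, h.2]) (huu w)
  have hE : ∀ e ∈ G.edgeSet, ∃ v, s(v, u v) = e := by
    intro e
    induction e with
    | _ v w =>
      intro h
      rcases (hG v w).1 h with rfl | rfl
      · exact ⟨v, rfl⟩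
      · exact ⟨w, Sym2.eq_swap⟩
  rw [← Fintype.card_subtype, ← Nat.card_eq_fintype_card, matchingCount]
  symm
  refine Nat.card_eq_of_bijective
    (fun S => ⟨S.1.map ⟨_, inj⟩, by simpa using S.2.1, ?_, ?_⟩) ⟨?_, ?_⟩
  · simp only [Finset.mem_map, Function.Embedding.coeFn_mk]
    rintro _ ⟨v, -, rfl⟩
    exact (hG _ _).2 (.inl rfl)
  · simp only [Finset.mem_map, Function.Embedding.coeFn_mk]
    rintro _ ⟨v, hv, rfl⟩ _ ⟨w, hw, rfl⟩ hne x hx hx'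
    have hvw : v ≠ w := fun h => hne (by rw [h])
    rw [Sym2.mem_iff] at hx hx'
    rcases hx with rfl | rfl <;> rcases hx' with h | h
    · exact hvw h
    · exact S.2.2 _ hw (h ▸ hv)
    · exact S.2.2 _ hv (h ▸ hw)
    · exact hvw (u.injective h)
  · intro S S' h
    exact Subtype.ext (Finset.map_injective _ (congrArg Subtype.val h))
  · rintro ⟨M, hM, hMG, hMM⟩
    have hmap : (Finset.univ.filter fun v => s(v, u v) ∈ M).map ⟨_, inj⟩ = M := by
      ext e
      simp only [Finset.mem_map, Finset.mem_filter, Finset.mem_univ, true_and,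
        Function.Embedding.coeFn_mk]
      constructor
      · rintro ⟨v, hv, rfl⟩
        exact hv
      · intro he
        obtain ⟨v, rfl⟩ := hE e (hMG e he)
        exact ⟨v, he, rfl⟩
    refine ⟨⟨Finset.univ.filter fun v => s(v, u v) ∈ M, ?_, ?_⟩, Subtype.ext hmap⟩
    · rw [← hM, ← congrArg Finset.card hmap, Finset.card_map]
    · simp only [Finset.mem_filter, Finset.mem_univ, true_and]
      intro v hv hv'
      exact hMM _ hv _ hv' (fun h => hu v (inj h).symm) (u v) (by simp) (by simp)

theorem eval_matchingPoly {V : Type*} [Fintype V] [DecidableEq V] (G : SimpleGraph V)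
    (u : Equiv.Perm V) (hu : ∀ v, u v ≠ v) (huu : ∀ v, u (u v) ≠ v)
    (hG : ∀ v w, G.Adj v w ↔ w = u v ∨ v = u w) {x : ℚ} (hx : x ≠ 0) :
    (matchingPoly G).eval x = ∑ S : Finset V,
      if ∀ v ∈ S, u v ∉ S then x ^ Fintype.card V * (-(x ^ 2)⁻¹) ^ S.card else 0 := by
  have hcard : ∀ S : Finset V, (∀ v ∈ S, u v ∉ S) → 2 * S.card ≤ Fintype.card V := by
    intro S hS
    have hd : Disjoint S (S.map u.toEmbedding) := by
      rw [Finset.disjoint_right]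
      intro y hy
      obtain ⟨v, hv, rfl⟩ := Finset.mem_map.1 hy
      exact hS v hv
    have := Finset.card_le_univ (S ∪ S.map u.toEmbedding)
    rw [Finset.card_union_of_disjoint hd, Finset.card_map] at this
    omega
  rw [matchingPoly, eval_finsetSum, ← Finset.sum_filter,
    ← Finset.sum_fiberwise_of_maps_to (t := Finset.range (Fintype.card V + 1)) (g := Finset.card)
      fun S _ => Finset.mem_range.2 (Nat.lt_succ_of_le S.card_le_univ)]
  refine Finset.sum_congr rfl fun i _ => ?_
  rw [matchingCount_eq_card_filter G u hu huu hG, eval_mul, eval_C, eval_pow, eval_X,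
    mul_right_comm, Finset.filter_filter, mul_comm, ← nsmul_eq_mul, ← Finset.sum_const]
  simp only [and_comm (a := _ = i)]
  refine Finset.sum_congr rfl fun S hS => ?_
  obtain ⟨hind, rfl⟩ := (Finset.mem_filter.1 hS).2
  have h2 := hcard S hind
  rw [← Nat.sub_add_cancel h2, pow_add, neg_pow (x ^ 2)⁻¹, Nat.add_sub_cancel, pow_mul, inv_pow]
  field_simp

/-- The permutation of the vertices of the cover that moves up one layer. -/
def coverShift {n d : ℕ} (lam : ZMod n → Equiv.Perm (Fin d)) : Equiv.Perm (ZMod n × Fin d) where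
  toFun p := (p.1 + 1, lam p.1 p.2)
  invFun p := (p.1 - 1, (lam (p.1 - 1)).symm p.2)
  left_inv p := by simp
  right_inv p := by simp

/-- Sets of vertices of the cover, described layer by layer. -/
def layersEquiv (n d : ℕ) [NeZero n] :
    Finset (ZMod n × Fin d) ≃ (ZMod n → Finset (Fin d)) where
  toFun S i := Finset.univ.filter fun j => (i, j) ∈ S
  invFun f := Finset.univ.filter fun p => p.2 ∈ f p.1
  left_inv S := by ext; simp
  right_inv f := by ext; simp

theorem card_layersEquiv_symm {n d : ℕ} [NeZero n] (f : ZMod n → Finset (Fin d)) :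
    ((layersEquiv n d).symm f).card = ∑ i, (f i).card := by
  simp only [layersEquiv, Equiv.coe_fn_symm_mk, Finset.card_filter, Fintype.sum_prod_type]
  simp

/-- Summing over all labelings decouples the layers of the cover. -/
theorem sum_eval_matchingPoly_coverGraph (n d : ℕ) [NeZero n] (hn : 3 ≤ n) {x : ℚ} (hx : x ≠ 0) :
    ∑ lam : ZMod n → Equiv.Perm (Fin d), (matchingPoly (coverGraph n d lam)).eval x =
      ∑ f : ZMod n → Finset (Fin d), ∏ i, x ^ d * (-(x ^ 2)⁻¹) ^ (f i).card *
        (Finset.univ.filter fun σ : Equiv.Perm (Fin d) => ∀ j ∈ f i, σ j ∉ f (i + 1)).card := by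
  have h1 : ((1 : ℕ) : ZMod n) ≠ 0 := by
    rw [Ne, ZMod.natCast_eq_zero_iff]
    exact fun h => by have := Nat.le_of_dvd one_pos h; omega
  have h2 : ((2 : ℕ) : ZMod n) ≠ 0 := by
    rw [Ne, ZMod.natCast_eq_zero_iff]
    exact fun h => by have := Nat.le_of_dvd two_pos h; omega
  have hu : ∀ (lam : ZMod n → Equiv.Perm (Fin d)) v, coverShift lam v ≠ v := by
    intro lam v h
    have := congrArg Prod.fst h
    simp only [coverShift, Equiv.coe_fn_mk, add_eq_left] at this
    exact h1 (by simpa using this)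
  have huu : ∀ (lam : ZMod n → Equiv.Perm (Fin d)) v, coverShift lam (coverShift lam v) ≠ v := by
    intro lam v h
    have := congrArg Prod.fst h
    simp only [coverShift, Equiv.coe_fn_mk, add_assoc, add_eq_left, one_add_one_eq_two] at this
    exact h2 (by simpa using this)
  have hG : ∀ (lam : ZMod n → Equiv.Perm (Fin d)) v w,
      (coverGraph n d lam).Adj v w ↔ w = coverShift lam v ∨ v = coverShift lam w := by
    intro lam v w
    simp only [coverGraph, SimpleGraph.fromRel_adj]
    have e1 : w = coverShift lam v ↔ w.1 = v.1 + 1 ∧ w.2 = lam v.1 v.2 := Prod.ext_iff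
    have e2 : v = coverShift lam w ↔ v.1 = w.1 + 1 ∧ v.2 = lam w.1 w.2 := Prod.ext_iff
    rw [← e1, ← e2, and_iff_right_iff_imp]
    rintro (h | h) rfl <;> exact hu lam _ h.symm
  simp only [eval_matchingPoly _ _ (hu _) (huu _) (hG _) hx,
    ← (layersEquiv n d).symm.sum_comp, card_layersEquiv_symm]
  rw [Finset.sum_comm]
  refine Finset.sum_congr rfl fun f _ => ?_
  have indep : ∀ lam : ZMod n → Equiv.Perm (Fin d),
      (∀ v ∈ (layersEquiv n d).symm f, coverShift lam v ∉ (layersEquiv n d).symm f) ↔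
        ∀ i, ∀ j ∈ f i, lam i j ∉ f (i + 1) := by
    intro lam
    simp [layersEquiv, coverShift]
  simp only [indep, Finset.card_filter, Nat.cast_sum, Finset.mul_sum, Fintype.prod_sum]
  refine Finset.sum_congr rfl fun lam _ => ?_
  simp only [Nat.cast_ite, Nat.cast_one, Nat.cast_zero, mul_ite, mul_one, mul_zero]
  split_ifs with h
  · rw [Finset.prod_congr rfl fun i _ => if_pos (h i), Finset.prod_mul_distrib,
      Finset.prod_pow_eq_pow_sum, Finset.prod_pow_eq_pow_sum, Fintype.card_prod]
    simp
  · obtain ⟨i, hi⟩ := not_forall.1 h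
    exact (Finset.prod_eq_zero (Finset.mem_univ i) (if_neg hi)).symm

/-- The transfer matrix between layers, indexed by the number of matched upward edges. -/
def transferMatrix (d : ℕ) (x : ℚ) : Matrix (Fin (d + 1)) (Fin (d + 1)) ℚ :=
  .of fun a b => x ^ d * (-(x ^ 2)⁻¹) ^ (a : ℕ) * ((d - a).choose b : ℕ)

theorem trace_mul_pow_comm {m n R : Type*} [Fintype m] [Fintype n] [DecidableEq m] [DecidableEq n]
    [CommRing R] (A : Matrix m n R) (B : Matrix n m R) {k : ℕ} (hk : k ≠ 0) :
    ((A * B) ^ k).trace = ((B * A) ^ k).trace := by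
  obtain ⟨k, rfl⟩ := Nat.exists_eq_succ_of_ne_zero hk
  have h : ∀ k, (A * B) ^ k * A = A * (B * A) ^ k := by
    intro k
    induction k with
    | zero => simp
    | succ k ih => rw [pow_succ', Matrix.mul_assoc, ih, pow_succ']; simp only [Matrix.mul_assoc]
  rw [Nat.succ_eq_add_one, pow_succ, ← Matrix.mul_assoc, h, Matrix.trace_mul_comm,
    ← Matrix.mul_assoc, ← pow_succ']

/-- The evaluation of the `d`-matching polynomial of a cycle as a trace. -/
theorem average_eval_matchingPoly_coverGraph (n d : ℕ) [NeZero n] (hn : 3 ≤ n) {x : ℚ}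
    (hx : x ≠ 0) :
    ((d.factorial : ℚ) ^ n)⁻¹ *
        ∑ lam : ZMod n → Equiv.Perm (Fin d), (matchingPoly (coverGraph n d lam)).eval x =
      (transferMatrix d x ^ n).trace := by
  let P : Matrix (Finset (Fin d)) (Fin (d + 1)) ℚ := .of fun S a => if S.card = a then 1 else 0
  let Q : Matrix (Fin (d + 1)) (Finset (Fin d)) ℚ := .of fun a T =>
    x ^ d * (-(x ^ 2)⁻¹) ^ (a : ℕ) * ((d - a).choose T.card : ℕ) / (d.choose T.card : ℕ)
  have hlt : ∀ S : Finset (Fin d), S.card < d + 1 := fun S => by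
    simpa [Nat.lt_succ_iff] using S.card_le_univ
  have hPQ : ∀ S T, (P * Q) S T =
      x ^ d * (-(x ^ 2)⁻¹) ^ S.card * ((d - S.card).choose T.card : ℕ) / (d.choose T.card : ℕ) := by
    intro S T
    rw [Matrix.mul_apply, Finset.sum_eq_single ⟨S.card, hlt S⟩]
    · simp [P, Q]
    · intro a _ ha
      have : S.card ≠ a := fun h => ha (Fin.ext h.symm)
      simp [P, this]
    · simp
  have hQP : Q * P = transferMatrix d x := by
    ext a b
    have hb : d.choose b ≠ 0 := (Nat.choose_pos (Nat.lt_succ_iff.1 b.2)).ne'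
    have hb' : ((d.choose b : ℕ) : ℚ) ≠ 0 := Nat.cast_ne_zero.2 hb
    simp only [Matrix.mul_apply, P, Q, Matrix.of_apply, mul_ite, mul_one, mul_zero,
      transferMatrix]
    rw [← Finset.sum_filter, Finset.sum_congr rfl fun S hS => by
      rw [(Finset.mem_filter.1 hS).2], Finset.sum_const,
      ← Finset.powerset_univ, ← Finset.powersetCard_eq_filter, Finset.card_powersetCard]
    simp only [Finset.card_univ, Fintype.card_fin, nsmul_eq_mul]
    field_simp
  rw [← hQP, ← trace_mul_pow_comm P Q (NeZero.ne n), ← sum_prod_matrix_cycle,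
    sum_eval_matchingPoly_coverGraph n d hn hx, Finset.mul_sum]
  refine Finset.sum_congr rfl fun f _ => ?_
  have hconst : ((d.factorial : ℚ) ^ n)⁻¹ = ∏ _i : ZMod n, ((d.factorial : ℚ))⁻¹ := by
    simp [ZMod.card]
  rw [hconst, ← Finset.prod_mul_distrib]
  refine Finset.prod_congr rfl fun i _ => ?_
  have hc : d.choose (f (i + 1)).card *
      (Finset.univ.filter fun σ : Equiv.Perm (Fin d) => ∀ j ∈ f i, σ j ∉ f (i + 1)).card =
        d.factorial * (d - (f i).card).choose (f (i + 1)).card := by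
    convert choose_mul_card_perm_disjoint (f i) (f (i + 1)) <;> simp
  have hc' := congrArg (Nat.cast : ℕ → ℚ) hc
  have h1 : ((d.choose (f (i + 1)).card : ℕ) : ℚ) ≠ 0 :=
    Nat.cast_ne_zero.2 (Nat.choose_pos (Nat.lt_succ_iff.1 (hlt _))).ne'
  have h2 : (d.factorial : ℚ) ≠ 0 := Nat.cast_ne_zero.2 d.factorial_ne_zero
  push_cast at hc'
  rw [hPQ, eq_div_iff h1, inv_mul_eq_div, div_mul_eq_mul_div, div_eq_iff h2]
  linear_combination (x ^ d * (-(x ^ 2)⁻¹) ^ (f i).card) * hc'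

theorem sum_choose_mul_pow_mul_pow {R : Type*} [CommRing R] {d a : ℕ} (ha : a ≤ d) (y z : R) :
    ∑ b : Fin (d + 1), (((d - a).choose b : ℕ) : R) * (y ^ (b : ℕ) * z ^ (d - b)) =
      z ^ a * (z + y) ^ (d - a) := by
  rw [Fin.sum_univ_eq_sum_range (fun b => (((d - a).choose b : ℕ) : R) * (y ^ b * z ^ (d - b))),
    add_comm z y, add_pow, Finset.mul_sum]
  symm
  refine Finset.sum_subset_zero_on_sdiff (by simp) ?_ ?_
  · intro b hb
    rw [Finset.mem_sdiff, Finset.mem_range, Finset.mem_range] at hb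
    rw [Nat.choose_eq_zero_of_lt (by omega)]
    simp
  · intro b hb
    rw [Finset.mem_range] at hb
    rw [show d - b = a + (d - a - b) by omega, pow_add]
    ring

/-- The coefficients of these polynomials form the eigenvectors of the transfer matrix. -/
def eigenPoly (d : ℕ) (t : ℚ) (a : ℕ) : ℚ[X] :=
  (C (-(t + t⁻¹)⁻¹) * (C t⁻¹ + C t * X)) ^ a * (1 + X) ^ (d - a)

theorem sum_transferMatrix_mul_eigenPoly (d : ℕ) {t : ℚ} (ht : 1 < t) (a : Fin (d + 1)) :
    ∑ b : Fin (d + 1), C (transferMatrix d (t + t⁻¹) a b) * eigenPoly d t b =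
      C (t ^ d) * (eigenPoly d t a).comp (C (t ^ 2)⁻¹ * X) := by
  have ht0 : t ≠ 0 := by positivity
  have hx : t + t⁻¹ ≠ 0 := by positivity
  set x := t + t⁻¹ with hxdef
  have ha := Nat.lt_succ_iff.1 a.2
  set y : ℚ[X] := C (-x⁻¹) * (C t⁻¹ + C t * X) with hy
  have hlhs : ∑ b : Fin (d + 1), C (transferMatrix d x a b) * eigenPoly d t b =
      C (x ^ d * (-(x ^ 2)⁻¹) ^ (a : ℕ)) * ((1 + X) ^ (a : ℕ) * (1 + X + y) ^ (d - a)) := by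
    rw [← sum_choose_mul_pow_mul_pow ha, Finset.mul_sum]
    refine Finset.sum_congr rfl fun b _ => ?_
    simp only [transferMatrix, Matrix.of_apply, eigenPoly, C_mul, ← hxdef, ← hy, map_natCast]
    ring
  have hz : 1 + X + y = C (x⁻¹ * t) * (1 + C (t ^ 2)⁻¹ * X) := by
    have e1 : 1 - x⁻¹ * t⁻¹ = x⁻¹ * t := by rw [hxdef] at hx ⊢; field_simp; ring
    have e2 : 1 - x⁻¹ * t = x⁻¹ * t * (t ^ 2)⁻¹ := by rw [hxdef] at hx ⊢; field_simp; ring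
    have f1 := congrArg C e1
    have f2 := congrArg C e2
    simp only [C_sub, C_mul, C_1] at f1 f2
    rw [hy]
    simp only [C_neg, C_mul]
    linear_combination f1 + X * f2
  have hy' : y.comp (C (t ^ 2)⁻¹ * X) = C (-(x⁻¹ * t⁻¹)) * (1 + X) := by
    have e : t * (t ^ 2)⁻¹ = t⁻¹ := by field_simp
    have f := congrArg C e
    simp only [C_mul] at f
    simp only [hy, mul_comp, add_comp, C_comp, X_comp]
    simp only [C_neg, C_mul]
    linear_combination (-C x⁻¹ * X) * f
  have hcoef : x ^ d * (-(x ^ 2)⁻¹) ^ (a : ℕ) * (x⁻¹ * t) ^ (d - a) =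
      t ^ d * (-(x⁻¹ * t⁻¹)) ^ (a : ℕ) := by
    obtain ⟨c, hc⟩ := Nat.exists_eq_add_of_le ha
    have hc' : d - a = c := by omega
    rw [hc', show x ^ d = x ^ ((a : ℕ) + c) by rw [← hc],
      show t ^ d = t ^ ((a : ℕ) + c) by rw [← hc],
      neg_pow (x ^ 2)⁻¹, neg_pow (x⁻¹ * t⁻¹)]
    simp only [pow_add, mul_pow, inv_pow]
    field_simp
    exact pow_right_comm _ _ _
  rw [hlhs, hz, eigenPoly, ← hxdef, ← hy, mul_comp, pow_comp, pow_comp, hy', add_comp, X_comp,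
    one_comp, mul_pow, mul_pow, ← C_pow, ← C_pow]
  have := congrArg C hcoef
  simp only [C_mul] at this ⊢
  linear_combination ((1 + X) ^ (a : ℕ) * (1 + C (t ^ 2)⁻¹ * X) ^ (d - (a : ℕ))) * this

/-- The transfer matrix at `t + t⁻¹` has eigenvalues `t ^ (d - 2 * k)`. -/
theorem trace_transferMatrix_pow (d n : ℕ) {t : ℚ} (ht : 1 < t) :
    (transferMatrix d (t + t⁻¹) ^ n).trace =
      ∑ k : Fin (d + 1), (t ^ d * (t ^ 2)⁻¹ ^ (k : ℕ)) ^ n := by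
  have ht0 : 0 < t := by positivity
  let V : Matrix (Fin (d + 1)) (Fin (d + 1)) ℚ := .of fun a k => (eigenPoly d t a).coeff k
  let D : Fin (d + 1) → ℚ := fun k => t ^ d * (t ^ 2)⁻¹ ^ (k : ℕ)
  have hV : transferMatrix d (t + t⁻¹) * V = V * Matrix.diagonal D := by
    ext a k
    have := congrArg (fun p => coeff p k) (sum_transferMatrix_mul_eigenPoly d ht a)
    simp only [finsetSum_coeff, coeff_C_mul, comp_C_mul_X_coeff] at this
    rw [Matrix.mul_apply, Matrix.mul_diagonal]
    simp only [V, D, Matrix.of_apply, this]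
    ring
  have hD : Function.Injective D := by
    intro k l h
    have h' := mul_left_cancel₀ (pow_pos ht0 d).ne' h
    exact Fin.ext (pow_right_injective₀ (by positivity)
      (inv_lt_one_of_one_lt₀ (one_lt_pow₀ ht two_ne_zero)).ne h')
  have hunit : IsUnit V := by
    rw [← Matrix.linearIndependent_cols_iff_isUnit]
    refine Module.End.eigenvectors_linearIndependent' (transferMatrix d (t + t⁻¹)).mulVecLin D hD
      _ fun k => ⟨Module.End.mem_eigenspace_iff.2 ?_, fun h => ?_⟩
    · ext a
      have := congrFun (congrFun hV a) k
      rw [Matrix.mul_diagonal, mul_comm] at this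
      exact this
    · have := congrFun h 0
      simp only [Matrix.col, V, Matrix.transpose_apply, Matrix.of_apply, eigenPoly,
        Fin.val_zero, pow_zero, one_mul, Nat.sub_zero, coeff_one_add_X_pow, Pi.zero_apply, Nat.cast_eq_zero] at this
      exact (Nat.choose_pos (Nat.lt_succ_iff.1 k.2)).ne' this
  have hpow : transferMatrix d (t + t⁻¹) ^ n * V = V * Matrix.diagonal D ^ n :=
    (SemiconjBy.pow_right (show SemiconjBy V (Matrix.diagonal D) _ from hV.symm) n).symm
  have hdet := (Matrix.isUnit_iff_isUnit_det V).1 hunit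
  calc _ = (transferMatrix d (t + t⁻¹) ^ n * V * V⁻¹).trace := by
        rw [Matrix.mul_nonsing_inv_cancel_right _ _ hdet]
    _ = (Matrix.diagonal D ^ n).trace := by
        rw [hpow, Matrix.trace_mul_comm, Matrix.nonsing_inv_mul_cancel_left _ _ hdet]
    _ = _ := by rw [Matrix.diagonal_pow, Matrix.trace_diagonal]; rfl

theorem eval_pathPoly_mul (m : ℕ) {t : ℚ} (ht : t ≠ 0) :
    (pathPoly m).eval (t + t⁻¹) * (t - t⁻¹) = t ^ (m + 1) - t⁻¹ ^ (m + 1) := by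
  induction m using Nat.twoStepInduction with
  | zero => simp [pathPoly]
  | one => simp only [pathPoly, eval_X]; ring
  | more m ih1 ih2 =>
    have h : t * t⁻¹ = 1 := mul_inv_cancel₀ ht
    simp only [pathPoly, eval_sub, eval_mul, eval_X]
    linear_combination (t + t⁻¹) * ih2 - ih1 + (t ^ (m + 1) - t⁻¹ ^ (m + 1)) * h

theorem sum_eigenvalue_pow_mul (d n : ℕ) {t : ℚ} (ht : t ≠ 0) :
    (∑ k : Fin (d + 1), (t ^ d * (t ^ 2)⁻¹ ^ (k : ℕ)) ^ n) * (t ^ n - t⁻¹ ^ n) =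
      t ^ (n * (d + 1)) - t⁻¹ ^ (n * (d + 1)) := by
  rw [Fin.sum_univ_eq_sum_range (fun k => (t ^ d * (t ^ 2)⁻¹ ^ k) ^ n), Finset.sum_mul]
  let F : ℕ → ℚ := fun k => (t ^ (d + 1) * (t ^ 2)⁻¹ ^ k) ^ n
  have hF : ∀ k, (t ^ d * (t ^ 2)⁻¹ ^ k) ^ n * (t ^ n - t⁻¹ ^ n) = F k - F (k + 1) := by
    intro k
    have e : t ^ d * (t ^ 2)⁻¹ ^ k * t⁻¹ = t ^ (d + 1) * (t ^ 2)⁻¹ ^ (k + 1) := by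
      rw [pow_succ t d, pow_succ _ k]
      field_simp
    simp only [F, ← e, mul_sub, ← mul_pow]
    ring
  simp only [hF]
  rw [Finset.sum_range_sub']
  have e : t ^ (d + 1) * (t ^ 2)⁻¹ ^ (d + 1) = t⁻¹ ^ (d + 1) := by
    rw [← mul_pow]
    congr 1
    field_simp
  simp only [F, e, pow_zero, mul_one, ← pow_mul, mul_comm n]

/-- Hall's conjecture: `𝒞_{n,d}(x) · 𝒫_{n−1}(x) = 𝒫_{nd+n−1}(x)`. -/
theorem dMatchingPoly_cycle_mul_pathPoly
    (n d : ℕ) [NeZero n] (hn : 3 ≤ n) (hd : 1 ≤ d) :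
    (Polynomial.C (((d.factorial : ℚ)) ^ n)⁻¹ *
        ∑ lam : ZMod n → Equiv.Perm (Fin d), matchingPoly (coverGraph n d lam)) *
        pathPoly (n - 1) =
      pathPoly (n * d + n - 1) := by
  have hinj : Set.InjOn (fun t : ℚ => t + t⁻¹) (Set.Ioi 1) := by
    intro s hs t ht h
    have hs1 : 1 < s := hs
    have ht1 : 1 < t := ht
    have hs0 : s ≠ 0 := by positivity
    have ht0 : t ≠ 0 := by positivity
    have hst : s * t - 1 ≠ 0 := by nlinarith
    have h' : (s - t) * (s * t - 1) = 0 := by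
      simp only at h
      field_simp at h
      linear_combination h
    exact sub_eq_zero.1 ((mul_eq_zero.1 h').resolve_right hst)
  refine eq_of_infinite_eval_eq _ _ (((Set.Ioi_infinite 1).image hinj).mono ?_)
  rintro _ ⟨t, ht, rfl⟩
  have ht1 : 1 < t := ht
  have ht0 : t ≠ 0 := by positivity
  have hsub : t - t⁻¹ ≠ 0 := (sub_pos.2 ((inv_lt_one_of_one_lt₀ ht1).trans ht1)).ne'
  rw [Set.mem_ofPred_eq]
  refine mul_right_cancel₀ hsub ?_
  rw [eval_pathPoly_mul _ ht0, eval_mul, eval_mul, eval_C, eval_finsetSum, mul_assoc,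
    eval_pathPoly_mul _ ht0, average_eval_matchingPoly_coverGraph n d hn (by positivity),
    trace_transferMatrix_pow d n ht1, Nat.sub_add_cancel (by omega), sum_eigenvalue_pow_mul d n ht0,
    Nat.sub_add_cancel (by omega), mul_add_one]

end
end

section
/- For every integer n ≥ 3 and every integer d ≥ 1, the d-matching polynomial of the n-cycle admits the expansion (1/(d!)^n) · Σ_{λ : ℤ/nℤ → S_d} M_{C_{n,λ}}(x) = (1/d!) · Σ_{σ ∈ S_d} Π_{i=1}^{d} (𝒞_{n·i}(x))^{μ_i(σ)}, where μ_i(σ) is the number of cycles of length i (fixed points counted as 1-cycles) in the disjoint cycle decomposition of σ. -/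
open Polynomial


noncomputable section

theorem Matrix.sum_fin_walk_mul {R B : Type*} [CommRing R] [Fintype B] [DecidableEq B]
    (A : Matrix B B R) (m : ℕ) (g : B → B → R) :
    ∑ b : Fin (m + 1) → B, (∏ k : Fin m, A (b k.castSucc) (b k.succ)) * g (b 0) (b (Fin.last m)) =
      ∑ x, ∑ y, (A ^ m) x y * g x y := by
  induction m generalizing g with
  | zero =>
    rw [← (Equiv.funUnique (Fin 1) B).symm.sum_comp]
    simp [Matrix.one_apply]
  | succ m ih =>
    rw [← (Fin.consEquiv fun _ : Fin (m + 2) => B).sum_comp, Fintype.sum_prod_type]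
    simp only [Fin.prod_univ_succ, Fin.consEquiv_apply, Fin.castSucc_zero, Fin.cons_zero,
      Fin.cons_succ, ← Fin.succ_castSucc, ← Fin.succ_last]
    refine Finset.sum_congr rfl fun x _ => ?_
    have h := ih fun y z => A x y * g x z
    calc _ = _ := Finset.sum_congr rfl fun b _ => by ring
      _ = _ := h
      _ = _ := by
        rw [Finset.sum_comm]
        refine Finset.sum_congr rfl fun z _ => ?_
        rw [pow_succ', Matrix.mul_apply, Finset.sum_mul]
        exact Finset.sum_congr rfl fun y _ => by ring

/-- The trace of a matrix power as a sum over closed walks. -/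
theorem Matrix.trace_pow_eq_sum_zmod {R B : Type*} [CommRing R] [Fintype B] [DecidableEq B]
    (A : Matrix B B R) (m : ℕ) [NeZero m] :
    (A ^ m).trace = ∑ b : ZMod m → B, ∏ k, A (b k) (b (k + 1)) := by
  obtain ⟨m, rfl⟩ := Nat.exists_eq_succ_of_ne_zero (NeZero.ne m)
  change _ = ∑ b : Fin (m + 1) → B, ∏ k : Fin (m + 1), A (b k) (b (k + 1))
  simp only [Fin.prod_univ_castSucc, Fin.coeSucc_eq_succ, Fin.last_add_one]
  rw [Matrix.sum_fin_walk_mul A m fun x y => A y x]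
  simp [Nat.succ_eq_add_one, pow_succ, Matrix.trace, Matrix.mul_apply]

/-- The sum over the permutations `σ` of `J` of the matrices of the `J`-fold tensor power of `A`
followed by `σ` permuting the factors. -/
def symmetrizedTensorPower {R B : Type*} [CommRing R] (J : Type*) [Fintype J] [DecidableEq J]
    (A : Matrix B B R) : Matrix (J → B) (J → B) R :=
  Matrix.of fun b c => ∑ σ : Equiv.Perm J, ∏ j, A (b j) (c (σ j))

theorem symmetrizedTensorPower_mul {R B J : Type*} [CommRing R] [Fintype J] [DecidableEq J]
    [Fintype B] (A A' : Matrix B B R) :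
    symmetrizedTensorPower J A * symmetrizedTensorPower J A' =
      ((Fintype.card J).factorial : R) • symmetrizedTensorPower J (A * A') := by
  ext b c
  simp only [symmetrizedTensorPower, Matrix.mul_apply, Matrix.of_apply, Matrix.smul_apply,
    Finset.sum_mul_sum]
  rw [Finset.sum_comm]
  have h (σ : Equiv.Perm J) : ∑ e : J → B, ∑ τ : Equiv.Perm J,
      (∏ j, A (b j) (e (σ j))) * ∏ j, A' (e j) (c (τ j)) =
        ∑ τ : Equiv.Perm J, ∏ j, ∑ x, A (b j) x * A' x (c (τ j)) := by
    rw [Finset.sum_comm, ← Equiv.sum_comp (Equiv.mulRight σ⁻¹)]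
    refine Finset.sum_congr rfl fun τ _ => ?_
    rw [Finset.prod_univ_sum, Fintype.piFinset_univ, ← Equiv.sum_comp (σ.arrowCongr (Equiv.refl B))]
    refine Finset.sum_congr rfl fun e _ => ?_
    rw [Finset.prod_mul_distrib]
    congr 1
    · simp
    · rw [← Equiv.prod_comp σ]
      simp
  rw [Finset.sum_congr rfl fun σ _ => h σ]
  simp [Fintype.card_perm]

theorem symmetrizedTensorPower_pow_succ {R B J : Type*} [CommRing R] [Fintype J] [DecidableEq J]
    [Fintype B] [DecidableEq B] (A : Matrix B B R) (n : ℕ) :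
    symmetrizedTensorPower J A ^ (n + 1) =
      ((Fintype.card J).factorial : R) ^ n • symmetrizedTensorPower J (A ^ (n + 1)) := by
  induction n with
  | zero => simp
  | succ n ih =>
    rw [pow_succ, ih, Matrix.smul_mul, symmetrizedTensorPower_mul, smul_smul, ← pow_succ,
      ← pow_succ]

/-- The transfer matrix of the matchings along a cycle. -/
def matchingTransfer : Matrix Bool Bool ℚ[X] :=
  Matrix.of fun a b => bif a then (bif b then 0 else -1) else (bif b then 1 else X)

theorem matchingTransfer_sq : matchingTransfer ^ 2 = (X : ℚ[X]) • matchingTransfer - 1 := by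
  ext a b : 1
  cases a <;> cases b <;> simp [pow_two, Matrix.mul_apply, matchingTransfer]
  ring

theorem trace_matchingTransfer_pow (n : ℕ) : (matchingTransfer ^ n).trace = cyclePoly n := by
  induction n using cyclePoly.induct with
  | case1 => simp [cyclePoly]
  | case2 => simp [cyclePoly, Matrix.trace, matchingTransfer]
  | case3 n ih₁ ih₀ =>
    rw [cyclePoly, ← ih₁, ← ih₀, Nat.succ_eq_add_one, add_assoc, pow_add _ n (1 + 1),
      one_add_one_eq_two, matchingTransfer_sq, mul_sub, Matrix.mul_smul,
      ← pow_succ, mul_one, Matrix.trace_sub, Matrix.trace_smul, smul_eq_mul]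

theorem prod_matchingTransfer {V : Type*} [Fintype V] [DecidableEq V] (π : Equiv.Perm V)
    (S : Finset V) :
    ∏ v, matchingTransfer (decide (v ∈ S)) (decide (π v ∈ S)) =
      if ∀ v ∈ S, π v ∉ S then (-1) ^ S.card * X ^ (Fintype.card V - 2 * S.card) else 0 := by
  split_ifs with hS
  · have h (v : V) : matchingTransfer (decide (v ∈ S)) (decide (π v ∈ S)) =
        (if v ∈ S then -1 else 1) * (if v ∉ S ∧ π v ∉ S then X else 1) := by
      by_cases h1 : v ∈ S
      · simp [h1, hS v h1, matchingTransfer]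
      · by_cases h2 : π v ∈ S <;> simp [h1, h2, matchingTransfer]
    simp only [h, Finset.prod_mul_distrib, Finset.prod_ite, Finset.prod_const, one_pow, mul_one,
      Finset.filter_univ_mem]
    congr 2
    have h1 : (Finset.univ.filter fun v => v ∉ S ∧ π v ∉ S) = (S ∪ S.map π.symm.toEmbedding)ᶜ := by
      ext v
      simp [Finset.mem_map_equiv]
    have h2 : Disjoint S (S.map π.symm.toEmbedding) := by
      rw [Finset.disjoint_left]
      intro v hv
      simpa [Finset.mem_map_equiv] using hS v hv
    rw [h1, Finset.card_compl, Finset.card_union_of_disjoint h2, Finset.card_map, two_mul]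
  · push Not at hS
    obtain ⟨v, hv, hv'⟩ := hS
    exact Finset.prod_eq_zero (Finset.mem_univ v) (by simp [hv, hv', matchingTransfer])

/-- The decomposition of a type into the cycles of a permutation. -/
def Equiv.Perm.sigmaZModEquiv {J : Type*} (σ : Equiv.Perm J) :
    (Σ ω : MulAction.orbitRel.Quotient (Subgroup.zpowers σ) J,
      ZMod (Function.minimalPeriod σ ω.out)) ≃ J :=
  ((MulAction.selfEquivSigmaOrbits (Subgroup.zpowers σ) J).trans
    (Equiv.sigmaCongrRight fun ω => MulAction.orbitZPowersEquiv σ ω.out)).symm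

theorem Equiv.Perm.sigmaZModEquiv_intCast {J : Type*} (σ : Equiv.Perm J)
    (ω : MulAction.orbitRel.Quotient (Subgroup.zpowers σ) J) (k : ℤ) :
    σ.sigmaZModEquiv ⟨ω, (k : ZMod (Function.minimalPeriod σ ω.out))⟩ = (σ ^ k) ω.out :=
  congrArg Subtype.val (MulAction.orbitZPowersEquiv_symm_apply' σ ω.out k)

theorem Equiv.Perm.apply_sigmaZModEquiv {J : Type*} (σ : Equiv.Perm J)
    (ω : MulAction.orbitRel.Quotient (Subgroup.zpowers σ) J)
    (k : ZMod (Function.minimalPeriod σ ω.out)) :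
    σ (σ.sigmaZModEquiv ⟨ω, k⟩) = σ.sigmaZModEquiv ⟨ω, k + 1⟩ := by
  obtain ⟨k, rfl⟩ := ZMod.intCast_surjective k
  rw [σ.sigmaZModEquiv_intCast, show (k : ZMod (Function.minimalPeriod σ ω.out)) + 1 =
    ((1 + k : ℤ) : ZMod _) by push_cast; ring, σ.sigmaZModEquiv_intCast, zpow_one_add,
    Equiv.Perm.mul_apply]

theorem Equiv.Perm.minimalPeriod_apply_zpow {J : Type*} (σ : Equiv.Perm J) (k : ℤ) (x : J) :
    Function.minimalPeriod σ ((σ ^ k) x) = Function.minimalPeriod σ x := by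
  refine Function.minimalPeriod_eq_minimalPeriod_iff.2 fun n => ?_
  simp only [Function.IsPeriodicPt, Function.IsFixedPt, ← Equiv.Perm.coe_pow]
  rw [← Equiv.Perm.mul_apply, ((Commute.refl σ).pow_left n |>.zpow_right k).eq,
    Equiv.Perm.mul_apply, (σ ^ k).injective.eq_iff]

theorem Equiv.Perm.minimalPeriod_sigmaZModEquiv {J : Type*} (σ : Equiv.Perm J)
    (ω : MulAction.orbitRel.Quotient (Subgroup.zpowers σ) J)
    (k : ZMod (Function.minimalPeriod σ ω.out)) :
    Function.minimalPeriod σ (σ.sigmaZModEquiv ⟨ω, k⟩) = Function.minimalPeriod σ ω.out := by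
  obtain ⟨k, rfl⟩ := ZMod.intCast_surjective k
  rw [σ.sigmaZModEquiv_intCast, σ.minimalPeriod_apply_zpow]

instance Equiv.Perm.neZero_minimalPeriod {J : Type*} [Finite J] (σ : Equiv.Perm J) (x : J) :
    NeZero (Function.minimalPeriod σ x) :=
  MulAction.minimalPeriod_pos σ x

theorem Equiv.Perm.sum_prod_eq_prod_trace {R B J : Type*} [CommRing R] [Fintype B] [DecidableEq B]
    [Fintype J] [DecidableEq J] (σ : Equiv.Perm J)
    [Fintype (MulAction.orbitRel.Quotient (Subgroup.zpowers σ) J)]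
    [DecidableEq (MulAction.orbitRel.Quotient (Subgroup.zpowers σ) J)] (A : Matrix B B R) :
    ∑ b : J → B, ∏ j, A (b j) (b (σ j)) =
      ∏ ω : MulAction.orbitRel.Quotient (Subgroup.zpowers σ) J,
        (A ^ Function.minimalPeriod σ ω.out).trace := by
  simp only [Matrix.trace_pow_eq_sum_zmod]
  rw [Finset.prod_univ_sum, Fintype.piFinset_univ,
    ← Equiv.sum_comp ((σ.sigmaZModEquiv.symm.arrowCongr (Equiv.refl B)).trans
      (Equiv.piCurry fun _ _ => B)).symm]
  refine Finset.sum_congr rfl fun b _ => ?_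
  rw [← Equiv.prod_comp σ.sigmaZModEquiv, Fintype.prod_sigma]
  simp [σ.apply_sigmaZModEquiv]
  rfl

theorem cycleCount_eq_card {d : ℕ} (σ : Equiv.Perm (Fin d))
    [Fintype (MulAction.orbitRel.Quotient (Subgroup.zpowers σ) (Fin d))] {i : ℕ} (hi : 0 < i) :
    cycleCount σ i = (Finset.univ.filter fun
      ω : MulAction.orbitRel.Quotient (Subgroup.zpowers σ) (Fin d) =>
        Function.minimalPeriod σ ω.out = i).card := by
  rw [cycleCount]
  refine Nat.div_eq_of_eq_mul_left hi ?_
  rw [Finset.card_filter, ← Equiv.sum_comp σ.sigmaZModEquiv, Fintype.sum_sigma, Finset.card_filter,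
    Finset.sum_mul]
  refine Finset.sum_congr rfl fun ω _ => ?_
  simp only [σ.minimalPeriod_sigmaZModEquiv]
  by_cases h : Function.minimalPeriod σ ω.out = i
  · simp [h]
  · simp [h]

theorem sum_prod_eq_prod_cycleCount {R B : Type*} [CommRing R] [Fintype B] [DecidableEq B]
    {d : ℕ} (σ : Equiv.Perm (Fin d)) (A : Matrix B B R) :
    ∑ b : Fin d → B, ∏ j, A (b j) (b (σ j)) =
      ∏ i ∈ Finset.Icc 1 d, (A ^ i).trace ^ cycleCount σ i := by
  classical
  have := Fintype.ofFinite (MulAction.orbitRel.Quotient (Subgroup.zpowers σ) (Fin d))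
  rw [σ.sum_prod_eq_prod_trace, ← Finset.prod_fiberwise_of_maps_to (t := Finset.Icc 1 d)
    (g := fun ω => Function.minimalPeriod σ ω.out)]
  · refine Finset.prod_congr rfl fun i hi => ?_
    rw [cycleCount_eq_card σ (Finset.mem_Icc.1 hi).1, ← Finset.prod_const]
    refine Finset.prod_congr rfl fun ω hω => ?_
    rw [(Finset.mem_filter.1 hω).2]
  · intro ω _
    rw [Finset.mem_Icc]
    refine ⟨Nat.one_le_iff_ne_zero.2 (NeZero.ne _), ?_⟩
    have h := MulAction.minimalPeriod_eq_card (a := σ) (b := ω.out)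
    have h' := Fintype.card_subtype_le (· ∈ MulAction.orbit (Subgroup.zpowers σ) ω.out)
    rw [Fintype.card_fin] at h'
    exact h.trans_le h'

/-- Matchings of the functional graph of a permutation without cycles of length at most two. -/
theorem matchingCount_fromRel_perm {V : Type*} [Fintype V] [DecidableEq V] (π : Equiv.Perm V)
    (h₁ : ∀ v, π v ≠ v) (h₂ : ∀ v, π (π v) ≠ v) (m : ℕ) :
    matchingCount (SimpleGraph.fromRel fun p q => q = π p) m =
      (Finset.univ.filter fun S : Finset V => S.card = m ∧ ∀ v ∈ S, π v ∉ S).card := by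
  have hinj : Function.Injective fun v => s(v, π v) := by
    intro v w h
    simp only [Sym2.eq_iff] at h
    rcases h with h | ⟨h, h'⟩
    · exact h.1
    · subst h
      exact absurd h' (h₂ w)
  rw [matchingCount, ← Fintype.card_subtype, ← Nat.card_eq_fintype_card]
  symm
  refine Nat.card_eq_of_bijective (fun S => ⟨S.1.map ⟨_, hinj⟩, ?_, ?_, ?_⟩) ⟨?_, ?_⟩
  · rw [Finset.card_map, S.2.1]
  · intro e he
    obtain ⟨v, -, rfl⟩ := Finset.mem_map.1 he
    simp [(h₁ v).symm]
  · intro e he f hf hef u hu hu'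
    obtain ⟨v, hv, rfl⟩ := Finset.mem_map.1 he
    obtain ⟨w, hw, rfl⟩ := Finset.mem_map.1 hf
    have hv' := S.2.2 v hv
    have hw' := S.2.2 w hw
    simp only [Function.Embedding.coeFn_mk, Sym2.mem_iff] at hu hu'
    rcases hu with rfl | rfl <;> rcases hu' with h | h
    · exact hef (by rw [h])
    · exact hw' (h ▸ hv)
    · exact hv' (h ▸ hw)
    · exact hef (by rw [π.injective h])
  · intro S S' h
    exact Subtype.ext (Finset.map_injective _ (congrArg Subtype.val h))
  · rintro ⟨M, hM, hadj, hdisj⟩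
    have hmap : (Finset.univ.filter fun v => s(v, π v) ∈ M).map ⟨_, hinj⟩ = M := by
      ext e
      simp only [Finset.mem_map, Finset.mem_filter, Finset.mem_univ, true_and,
        Function.Embedding.coeFn_mk]
      constructor
      · rintro ⟨v, hv, rfl⟩
        exact hv
      · intro he
        induction e with
        | _ x y =>
          have h := hadj _ he
          rw [SimpleGraph.mem_edgeSet, SimpleGraph.fromRel_adj] at h
          rcases h.2 with rfl | rfl
          · exact ⟨x, he, rfl⟩
          · exact ⟨y, Sym2.eq_swap ▸ he, Sym2.eq_swap⟩
    refine ⟨⟨Finset.univ.filter fun v => s(v, π v) ∈ M, ?_, ?_⟩, Subtype.ext hmap⟩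
    · rw [← hM, ← Finset.card_map ⟨_, hinj⟩, hmap]
    · simp only [Finset.mem_filter, Finset.mem_univ, true_and]
      intro v hv hv'
      exact hdisj _ hv _ hv' (fun h => h₁ v (hinj h).symm) (π v) (by simp) (by simp)

theorem matchingPoly_fromRel_perm {V : Type*} [Fintype V] [DecidableEq V] (π : Equiv.Perm V)
    (h₁ : ∀ v, π v ≠ v) (h₂ : ∀ v, π (π v) ≠ v) :
    matchingPoly (SimpleGraph.fromRel fun p q => q = π p) =
      ∑ b : V → Bool, ∏ v, matchingTransfer (b v) (b (π v)) := by
  let e : Finset V ≃ (V → Bool) :=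
    { toFun := fun S v => decide (v ∈ S)
      invFun := fun b => Finset.univ.filter fun v => b v = true
      left_inv := fun S => by simp
      right_inv := fun b => by simp }
  rw [← Equiv.sum_comp e]
  simp only [e, Equiv.coe_fn_mk, prod_matchingTransfer]
  rw [← Finset.sum_filter, ← Finset.sum_fiberwise_of_maps_to
    (t := Finset.range (Fintype.card V + 1)) (g := Finset.card)
    fun S _ => Finset.mem_range_succ_iff.2 S.card_le_univ, matchingPoly]
  refine Finset.sum_congr rfl fun m _ => ?_
  rw [Finset.sum_congr rfl fun S hS => by rw [(Finset.mem_filter.1 hS).2], Finset.sum_const,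
    matchingCount_fromRel_perm π h₁ h₂, Finset.filter_filter]
  simp only [and_comm, nsmul_eq_mul, map_mul, map_pow, map_neg, map_one, map_natCast]
  ring

/-- The permutation of the vertices of `coverGraph` moving along the cover. -/
def coverPerm (n d : ℕ) (lam : ZMod n → Equiv.Perm (Fin d)) : Equiv.Perm (ZMod n × Fin d) where
  toFun p := (p.1 + 1, lam p.1 p.2)
  invFun p := (p.1 - 1, (lam (p.1 - 1)).symm p.2)
  left_inv p := by simp
  right_inv p := by simp

theorem matchingPoly_coverGraph (n d : ℕ) [NeZero n] (hn : 3 ≤ n)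
    (lam : ZMod n → Equiv.Perm (Fin d)) :
    matchingPoly (coverGraph n d lam) =
      ∑ b : ZMod n → Fin d → Bool, ∏ k, ∏ j, matchingTransfer (b k j) (b (k + 1) (lam k j)) := by
  have hG : coverGraph n d lam = SimpleGraph.fromRel fun p q => q = coverPerm n d lam p := by
    simp only [coverGraph, coverPerm, Equiv.coe_fn_mk, Prod.ext_iff]
  have hn1 : (1 : ZMod n) ≠ 0 := by
    have : Fact (1 < n) := ⟨by lia⟩
    exact one_ne_zero
  have hn2 : (1 + 1 : ZMod n) ≠ 0 := by
    intro h
    have h' : ((2 : ℕ) : ZMod n) = 0 := by push_cast; rw [← h]; norm_num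
    have := Nat.le_of_dvd two_pos ((ZMod.natCast_eq_zero_iff 2 n).1 h')
    lia
  rw [hG, matchingPoly_fromRel_perm]
  · rw [← Equiv.sum_comp (Equiv.curry (ZMod n) (Fin d) Bool)]
    simp [Fintype.prod_prod_type, coverPerm]
  · intro v hv
    exact hn1 (by simpa [coverPerm] using congrArg Prod.fst hv)
  · intro v hv
    exact hn2 (by simpa [coverPerm, add_assoc] using congrArg Prod.fst hv)

theorem sum_matchingPoly_coverGraph (n d : ℕ) [NeZero n] (hn : 3 ≤ n) :
    ∑ lam : ZMod n → Equiv.Perm (Fin d), matchingPoly (coverGraph n d lam) =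
      (symmetrizedTensorPower (Fin d) matchingTransfer ^ n).trace := by
  simp only [matchingPoly_coverGraph n d hn]
  rw [Finset.sum_comm, Matrix.trace_pow_eq_sum_zmod]
  refine Finset.sum_congr rfl fun b _ => ?_
  simp only [symmetrizedTensorPower, Matrix.of_apply]
  rw [Finset.prod_univ_sum, Fintype.piFinset_univ]

theorem trace_symmetrizedTensorPower {R B : Type*} [CommRing R] [Fintype B] [DecidableEq B] (d : ℕ)
    (A : Matrix B B R) :
    (symmetrizedTensorPower (Fin d) A).trace =
      ∑ σ : Equiv.Perm (Fin d), ∏ i ∈ Finset.Icc 1 d, (A ^ i).trace ^ cycleCount σ i := by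
  simp only [Matrix.trace, Matrix.diag_apply, symmetrizedTensorPower, Matrix.of_apply]
  rw [Finset.sum_comm]
  exact Finset.sum_congr rfl fun σ _ => sum_prod_eq_prod_cycleCount σ A

/-- Expansion of the `d`-matching polynomial of the `n`-cycle over permutations. -/
theorem dMatchingPoly_cycle_eq_avg_cycleType_prod
    (n d : ℕ) [NeZero n] (hn : 3 ≤ n) (hd : 1 ≤ d) :
    Polynomial.C (((d.factorial : ℚ)) ^ n)⁻¹ *
        ∑ lam : ZMod n → Equiv.Perm (Fin d), matchingPoly (coverGraph n d lam) =
      Polynomial.C ((d.factorial : ℚ))⁻¹ *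
        ∑ σ : Equiv.Perm (Fin d),
          ∏ i ∈ Finset.Icc 1 d, cyclePoly (n * i) ^ cycleCount σ i := by
  rw [sum_matchingPoly_coverGraph n d hn]
  simp only [← trace_matchingTransfer_pow, pow_mul]
  rw [← trace_symmetrizedTensorPower]
  obtain ⟨n, rfl⟩ := Nat.exists_eq_succ_of_ne_zero (NeZero.ne n)
  have hd' : (d.factorial : ℚ) ≠ 0 := Nat.cast_ne_zero.2 d.factorial_ne_zero
  rw [Nat.succ_eq_add_one, symmetrizedTensorPower_pow_succ, Matrix.trace_smul, smul_eq_mul,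
    ← mul_assoc, Fintype.card_fin, ← map_natCast (C : ℚ →+* ℚ[X]), ← map_pow, ← map_mul]
  congr 2
  field_simp
  ring

end
end
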